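/- Let N, M, s, s' be positive integers, r a positive divisor of N and r̄ a positive divisor of M, ℓ := N/r, ℓ̄ := M/r̄. Fix h_{j,1} : ℤ/Nℤ → ℂ for j = 1,…,s and h_{j',2} : ℤ/Mℤ → ℂ for j' = 1,…,s'. For x : ℤ/Nℤ × ℤ/Mℤ → ℂ define the samples ℒ_{jj'}x(rn, r̄m) := Σ_{p∈ℤ/Nℤ} Σ_{q∈ℤ/Mℤ} x(p,q) · conj(h_{j,1}(p−rn)) · conj(h_{j',2}(q−r̄m)), for n = 0,…,ℓ−1 and m = 0,…,ℓ̄−1. Let R₁ be the sℓ×N matrix whose row indexed by (j,n) has p-th entry conj(h_{j,1}(p−rn)), and R₂ the s'ℓ̄×M matrix whose row indexed by (j',m) has q-th entry conj(h_{j',2}(q−r̄m)). Then the following are equivalent: (a) rank R₁ = N and rank R₂ = M; (b) there exist c_j : ℤ/Nℤ → ℂ (j = 1,…,s) and d_{j'} : ℤ/Mℤ → ℂ (j' = 1,…,s') such that every x : ℤ/Nℤ × ℤ/Mℤ → ℂ satisfies x(p,q) = Σ_{j=1}^{s} Σ_{j'=1}^{s'} Σ_{n=0}^{ℓ−1} Σ_{m=0}^{ℓ̄−1}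 ℒ_{jj'}x(rn, r̄m) · c_j(p−rn) · d_{j'}(q−r̄m) for all (p,q); (c) there exists a family C_{j,j',n,m} : ℤ/Nℤ × ℤ/Mℤ → ℂ such that every x satisfies x = Σ_{j,j',n,m} ℒ_{jj'}x(rn, r̄m) · C_{j,j',n,m}. -/

import Mathlib

open Complex

noncomputable section

/-- The generalized sample `ℒx(a,b) = Σ_{p,q} x(p,q) conj(h₁(p-a)) conj(h₂(q-b))`. -/
def sample {N M : ℕ} [NeZero N] [NeZero M] (h1 : ZMod N → ℂ) (h2 : ZMod M → ℂ)
    (x : ZMod N × ZMod M → ℂ) (a : ZMod N) (b : ZMod M) : ℂ :=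
  ∑ p : ZMod N, ∑ q : ZMod M,
    x (p, q) * (starRingEnd ℂ) (h1 (p - a)) * (starRingEnd ℂ) (h2 (q - b))

/-- A matrix whose rank is its number of columns acts injectively, and conversely. -/
theorem Matrix.rank_eq_card_iff_mulVec_injective {m n : Type*} [Fintype m] [Fintype n]
    [DecidableEq n] (A : Matrix m n ℂ) :
    A.rank = Fintype.card n ↔ Function.Injective A.mulVec := by
  have key := A.mulVecLin.finrank_range_add_finrank_ker
  rw [Module.finrank_fintype_fun_eq_card] at key
  change Module.finrank ℂ (LinearMap.range A.mulVecLin) = _ ↔ Function.Injective A.mulVecLin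
  rw [← LinearMap.ker_eq_bot, ← Submodule.finrank_eq_zero (R := ℂ)]
  omega

theorem Matrix.exists_left_inverse_of_mulVec_injective {m n : Type*} [Fintype m] [Fintype n]
    [DecidableEq m] [DecidableEq n] {A : Matrix m n ℂ} (hA : Function.Injective A.mulVec) :
    ∃ L : Matrix n m ℂ, L * A = 1 := by
  obtain ⟨g, hg⟩ := (Matrix.toLin' A).exists_leftInverse_of_injective
    (LinearMap.ker_eq_bot.2 hA)
  refine ⟨LinearMap.toMatrix' g, ?_⟩
  rw [← LinearMap.toMatrix'_toLin' A, ← LinearMap.toMatrix'_comp, hg, LinearMap.toMatrix'_id]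

/-- Averaging a left inverse of a shift-covariant matrix over the shifts yields a left inverse that
is itself generated by shifts. -/
theorem exists_shift_dual {G K ι : Type*} [AddCommGroup G] [DecidableEq G] [Fintype G]
    [AddCommGroup K] [Fintype K] [Fintype ι] (φ : K →+ G) (g : ι → G → ℂ)
    (L : Matrix G (ι × K) ℂ)
    (hL : L * (Matrix.of fun (jn : ι × K) p => g jn.1 (p - φ jn.2)) = 1) :
    ∃ c : ι → G → ℂ, ∀ p p' : G,
      ∑ jn : ι × K, g jn.1 (p' - φ jn.2) * c jn.1 (p - φ jn.2) = if p = p' then 1 else 0 := by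
  have hL' (p p' : G) :
      ∑ j, ∑ n, L p (j, n) * g j (p' - φ n) = if p = p' then 1 else 0 := by
    have := congrFun (congrFun hL p) p'
    rwa [Matrix.mul_apply, Fintype.sum_prod_type, Matrix.one_apply] at this
  have hK : (Fintype.card K : ℂ) ≠ 0 := Nat.cast_ne_zero.2 Fintype.card_ne_zero
  refine ⟨fun j u => (Fintype.card K : ℂ)⁻¹ * ∑ n, L (u + φ n) (j, n), fun p p' => ?_⟩
  have reindex (j : ι) :
      ∑ n, g j (p' - φ n) * ((Fintype.card K : ℂ)⁻¹ * ∑ n', L (p - φ n + φ n') (j, n')) =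
        (Fintype.card K : ℂ)⁻¹ * ∑ k, ∑ n, L (p - φ k) (j, n) * g j (p' - φ k - φ n) := by
    simp only [Finset.mul_sum]
    refine Finset.sum_comm.trans (Eq.trans ?_ Finset.sum_comm)
    refine Finset.sum_congr rfl fun n' _ => ?_
    refine Fintype.sum_equiv (Equiv.subRight n') _ _ fun n => ?_
    have e1 : p - φ (n - n') = p - φ n + φ n' := by rw [map_sub]; abel
    have e2 : p' - φ (n - n') - φ n' = p' - φ n := by rw [map_sub]; abel
    simp only [Equiv.subRight_apply, e1, e2]
    ring
  rw [Fintype.sum_prod_type]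
  simp only [reindex]
  rw [← Finset.mul_sum, Finset.sum_comm]
  simp only [hL', sub_left_inj, Finset.sum_const, Finset.card_univ, nsmul_eq_mul]
  rw [inv_mul_cancel_left₀ hK]

/-- The homomorphism `n ↦ r * n` from the cyclic group of order `ℓ` to that of order `r * ℓ`. -/
def shiftHom {N r ℓ : ℕ} [NeZero ℓ] (h : r * ℓ = N) : Fin ℓ →+ ZMod N :=
  AddMonoidHom.mk' (fun n => ((r * (n : ℕ) : ℕ) : ZMod N)) fun a b => by
    rw [← Nat.cast_add, ZMod.natCast_eq_natCast_iff, Fin.val_add, ← mul_add, ← h]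
    exact Nat.ModEq.mul_left' r (Nat.mod_modEq _ _)

theorem exists_shift_dual_of_rank {N s r ℓ : ℕ} [NeZero N] (h : r * ℓ = N)
    (g : Fin s → ZMod N → ℂ)
    (hrank : (Matrix.of fun (jn : Fin s × Fin ℓ) (p : ZMod N) =>
      g jn.1 (p - ((r * (jn.2 : ℕ) : ℕ) : ZMod N))).rank = N) :
    ∃ c : Fin s → ZMod N → ℂ, ∀ p p' : ZMod N,
      ∑ jn : Fin s × Fin ℓ, g jn.1 (p' - ((r * (jn.2 : ℕ) : ℕ) : ZMod N)) *
        c jn.1 (p - ((r * (jn.2 : ℕ) : ℕ) : ZMod N)) = if p = p' then 1 else 0 := by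
  have : NeZero ℓ := ⟨by rintro rfl; exact NeZero.ne N (by simpa using h.symm)⟩
  obtain ⟨L, hL⟩ := Matrix.exists_left_inverse_of_mulVec_injective
    ((Matrix.rank_eq_card_iff_mulVec_injective _).1 (hrank.trans (ZMod.card N).symm))
  exact exists_shift_dual (shiftHom h) g L hL

theorem sum_tensor_reconstruct {α β ι κ : Type*} [Fintype α] [Fintype β] [Fintype ι] [Fintype κ]
    [DecidableEq α] [DecidableEq β] (A : ι → α → ℂ) (B : κ → β → ℂ) (C : ι → α → ℂ)
    (D : κ → β → ℂ) (hA : ∀ p p', ∑ i, A i p' * C i p = if p = p' then 1 else 0)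
    (hB : ∀ q q', ∑ k, B k q' * D k q = if q = q' then 1 else 0)
    (x : α × β → ℂ) (p : α) (q : β) :
    x (p, q) = ∑ i, ∑ k, (∑ p', ∑ q', x (p', q') * A i p' * B k q') * C i p * D k q := by
  symm
  calc ∑ i, ∑ k, (∑ p', ∑ q', x (p', q') * A i p' * B k q') * C i p * D k q
      = ∑ i, ∑ k, ∑ p', ∑ q', x (p', q') * ((A i p' * C i p) * (B k q' * D k q)) := by
        simp only [Finset.sum_mul]
        refine Finset.sum_congr rfl fun i _ => Finset.sum_congr rfl fun k _ =>
          Finset.sum_congr rfl fun p' _ => Finset.sum_congr rfl fun q' _ => by ring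
    _ = ∑ z : ι × κ, ∑ y : α × β,
          x y * ((A z.1 y.1 * C z.1 p) * (B z.2 y.2 * D z.2 q)) := by
        simp only [Fintype.sum_prod_type]
    _ = ∑ y : α × β, ∑ z : ι × κ,
          x y * ((A z.1 y.1 * C z.1 p) * (B z.2 y.2 * D z.2 q)) := Finset.sum_comm
    _ = ∑ p', ∑ q', x (p', q') * ((∑ i, A i p' * C i p) * ∑ k, B k q' * D k q) := by
        simp only [Fintype.sum_prod_type, Finset.sum_mul_sum]
        simp only [Finset.mul_sum]
    _ = x (p, q) := by simp [hA, hB]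

theorem sample_tensor {N M : ℕ} [NeZero N] [NeZero M] (h1 : ZMod N → ℂ) (h2 : ZMod M → ℂ)
    (v : ZMod N → ℂ) (w : ZMod M → ℂ) (a : ZMod N) (b : ZMod M) :
    sample h1 h2 (fun y => v y.1 * w y.2) a b =
      (∑ p, (starRingEnd ℂ) (h1 (p - a)) * v p) * ∑ q, (starRingEnd ℂ) (h2 (q - b)) * w q := by
  rw [sample, Finset.sum_mul_sum]
  exact Finset.sum_congr rfl fun p _ => Finset.sum_congr rfl fun q _ => by ring

theorem rank_eq_of_mulVec_eq_zero {m : Type*} [Fintype m] {N : ℕ} [NeZero N]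
    (A : Matrix m (ZMod N) ℂ) (hA : ∀ v, A.mulVec v = 0 → v = 0) : A.rank = N := by
  refine ((Matrix.rank_eq_card_iff_mulVec_injective A).2 ?_).trans (ZMod.card N)
  exact (injective_iff_map_eq_zero A.mulVecLin).2 hA

theorem statement11 (N M s s' r rbar ℓ ℓbar : ℕ) [NeZero N] [NeZero M]
    (hs : 0 < s) (hs' : 0 < s') (hr : 0 < r) (hrbar : 0 < rbar)
    (hℓ : r * ℓ = N) (hℓbar : rbar * ℓbar = M)
    (h1 : Fin s → ZMod N → ℂ) (h2 : Fin s' → ZMod M → ℂ) :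
    -- (a) ↔ (b)
    (((Matrix.of fun jn : Fin s × Fin ℓ => fun p : ZMod N =>
          (starRingEnd ℂ) (h1 jn.1 (p - ((r * (jn.2 : ℕ) : ℕ) : ZMod N)))).rank = N ∧
      (Matrix.of fun jm : Fin s' × Fin ℓbar => fun q : ZMod M =>
          (starRingEnd ℂ) (h2 jm.1 (q - ((rbar * (jm.2 : ℕ) : ℕ) : ZMod M)))).rank = M)
      ↔
      (∃ (c : Fin s → ZMod N → ℂ) (d : Fin s' → ZMod M → ℂ),
        ∀ x : ZMod N × ZMod M → ℂ, ∀ p : ZMod N, ∀ q : ZMod M,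
          x (p, q) =
            ∑ j : Fin s, ∑ j' : Fin s', ∑ n : Fin ℓ, ∑ m : Fin ℓbar,
              sample (h1 j) (h2 j') x ((r * (n : ℕ) : ℕ) : ZMod N)
                  ((rbar * (m : ℕ) : ℕ) : ZMod M) *
                c j (p - ((r * (n : ℕ) : ℕ) : ZMod N)) *
                d j' (q - ((rbar * (m : ℕ) : ℕ) : ZMod M)))) ∧
    -- (a) ↔ (c)
    (((Matrix.of fun jn : Fin s × Fin ℓ => fun p : ZMod N =>
          (starRingEnd ℂ) (h1 jn.1 (p - ((r * (jn.2 : ℕ) : ℕ) : ZMod N)))).rank = N ∧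
      (Matrix.of fun jm : Fin s' × Fin ℓbar => fun q : ZMod M =>
          (starRingEnd ℂ) (h2 jm.1 (q - ((rbar * (jm.2 : ℕ) : ℕ) : ZMod M)))).rank = M)
      ↔
      (∃ C : Fin s → Fin s' → Fin ℓ → Fin ℓbar → (ZMod N × ZMod M → ℂ),
        ∀ x : ZMod N × ZMod M → ℂ, ∀ pq : ZMod N × ZMod M,
          x pq =
            ∑ j : Fin s, ∑ j' : Fin s', ∑ n : Fin ℓ, ∑ m : Fin ℓbar,
              sample (h1 j) (h2 j') x ((r * (n : ℕ) : ℕ) : ZMod N)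
                  ((rbar * (m : ℕ) : ℕ) : ZMod M) * C j j' n m pq)) := by
  have hab (ha : (Matrix.of fun jn : Fin s × Fin ℓ => fun p : ZMod N =>
          (starRingEnd ℂ) (h1 jn.1 (p - ((r * (jn.2 : ℕ) : ℕ) : ZMod N)))).rank = N ∧
      (Matrix.of fun jm : Fin s' × Fin ℓbar => fun q : ZMod M =>
          (starRingEnd ℂ) (h2 jm.1 (q - ((rbar * (jm.2 : ℕ) : ℕ) : ZMod M)))).rank = M) :
      ∃ (c : Fin s → ZMod N → ℂ) (d : Fin s' → ZMod M → ℂ),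
        ∀ x : ZMod N × ZMod M → ℂ, ∀ p : ZMod N, ∀ q : ZMod M,
          x (p, q) =
            ∑ j : Fin s, ∑ j' : Fin s', ∑ n : Fin ℓ, ∑ m : Fin ℓbar,
              sample (h1 j) (h2 j') x ((r * (n : ℕ) : ℕ) : ZMod N)
                  ((rbar * (m : ℕ) : ℕ) : ZMod M) *
                c j (p - ((r * (n : ℕ) : ℕ) : ZMod N)) *
                d j' (q - ((rbar * (m : ℕ) : ℕ) : ZMod M)) := by
    obtain ⟨c, hc⟩ := exists_shift_dual_of_rank hℓ (fun j p => (starRingEnd ℂ) (h1 j p)) ha.1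
    obtain ⟨d, hd⟩ := exists_shift_dual_of_rank hℓbar (fun j p => (starRingEnd ℂ) (h2 j p)) ha.2
    refine ⟨c, d, fun x p q => ?_⟩
    have := sum_tensor_reconstruct
      (fun (i : Fin s × Fin ℓ) p' => (starRingEnd ℂ) (h1 i.1 (p' - ((r * (i.2 : ℕ) : ℕ) : ZMod N))))
      (fun (k : Fin s' × Fin ℓbar) q' =>
        (starRingEnd ℂ) (h2 k.1 (q' - ((rbar * (k.2 : ℕ) : ℕ) : ZMod M))))
      (fun i p => c i.1 (p - ((r * (i.2 : ℕ) : ℕ) : ZMod N)))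
      (fun k q => d k.1 (q - ((rbar * (k.2 : ℕ) : ℕ) : ZMod M))) hc hd x p q
    simp only [Fintype.sum_prod_type] at this
    rw [this]
    exact Finset.sum_congr rfl fun j _ => Finset.sum_comm
  have hbc (hb : ∃ (c : Fin s → ZMod N → ℂ) (d : Fin s' → ZMod M → ℂ),
        ∀ x : ZMod N × ZMod M → ℂ, ∀ p : ZMod N, ∀ q : ZMod M,
          x (p, q) =
            ∑ j : Fin s, ∑ j' : Fin s', ∑ n : Fin ℓ, ∑ m : Fin ℓbar,
              sample (h1 j) (h2 j') x ((r * (n : ℕ) : ℕ) : ZMod N)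
                  ((rbar * (m : ℕ) : ℕ) : ZMod M) *
                c j (p - ((r * (n : ℕ) : ℕ) : ZMod N)) *
                d j' (q - ((rbar * (m : ℕ) : ℕ) : ZMod M))) :
      ∃ C : Fin s → Fin s' → Fin ℓ → Fin ℓbar → (ZMod N × ZMod M → ℂ),
        ∀ x : ZMod N × ZMod M → ℂ, ∀ pq : ZMod N × ZMod M,
          x pq =
            ∑ j : Fin s, ∑ j' : Fin s', ∑ n : Fin ℓ, ∑ m : Fin ℓbar,
              sample (h1 j) (h2 j') x ((r * (n : ℕ) : ℕ) : ZMod N)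
                  ((rbar * (m : ℕ) : ℕ) : ZMod M) * C j j' n m pq := by
    obtain ⟨c, d, hcd⟩ := hb
    refine ⟨fun j j' n m pq => c j (pq.1 - ((r * (n : ℕ) : ℕ) : ZMod N)) *
      d j' (pq.2 - ((rbar * (m : ℕ) : ℕ) : ZMod M)), fun x pq => ?_⟩
    simpa only [mul_assoc] using hcd x pq.1 pq.2
  have hca (hC : ∃ C : Fin s → Fin s' → Fin ℓ → Fin ℓbar → (ZMod N × ZMod M → ℂ),
        ∀ x : ZMod N × ZMod M → ℂ, ∀ pq : ZMod N × ZMod M,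
          x pq =
            ∑ j : Fin s, ∑ j' : Fin s', ∑ n : Fin ℓ, ∑ m : Fin ℓbar,
              sample (h1 j) (h2 j') x ((r * (n : ℕ) : ℕ) : ZMod N)
                  ((rbar * (m : ℕ) : ℕ) : ZMod M) * C j j' n m pq) :
      (Matrix.of fun jn : Fin s × Fin ℓ => fun p : ZMod N =>
          (starRingEnd ℂ) (h1 jn.1 (p - ((r * (jn.2 : ℕ) : ℕ) : ZMod N)))).rank = N ∧
      (Matrix.of fun jm : Fin s' × Fin ℓbar => fun q : ZMod M =>
          (starRingEnd ℂ) (h2 jm.1 (q - ((rbar * (jm.2 : ℕ) : ℕ) : ZMod M)))).rank = M := by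
    obtain ⟨C, hC⟩ := hC
    refine ⟨rank_eq_of_mulVec_eq_zero _ fun v hv => funext fun p => ?_,
      rank_eq_of_mulVec_eq_zero _ fun w hw => funext fun q => ?_⟩
    · have hv' (j : Fin s) (n : Fin ℓ) :
          ∑ p, (starRingEnd ℂ) (h1 j (p - ((r * (n : ℕ) : ℕ) : ZMod N))) * v p = 0 :=
        congrFun hv (j, n)
      have hp := hC (fun y => v y.1 * (1 : ZMod M → ℂ) y.2) (p, 0)
      simp only [sample_tensor, hv', zero_mul, Finset.sum_const_zero] at hp
      simpa using hp
    · have hw' (j : Fin s') (m : Fin ℓbar) :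
          ∑ q, (starRingEnd ℂ) (h2 j (q - ((rbar * (m : ℕ) : ℕ) : ZMod M))) * w q = 0 :=
        congrFun hw (j, m)
      have hq := hC (fun y => (1 : ZMod N → ℂ) y.1 * w y.2) (0, q)
      simp only [sample_tensor, hw', mul_zero, zero_mul, Finset.sum_const_zero] at hq
      simpa using hq
  exact ⟨⟨hab, hca ∘ hbc⟩, ⟨hbc ∘ hab, hca⟩⟩
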